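/- Suppose a, b : ℤ² \ {0} → ℂ satisfy, for all nonzero m, n ∈ ℤ² with m+n ≠ 0: 2·det(n;m)·b(m+n) = a(m) + det(n;m)·b(n) and 2·a(m+n) = det(n;m)·b(m) − det(n;m)·b(n), where a is a constant function a(m) = a. Then a = 0 and b ≡ 0. -/

import Mathlib

/-- coefficient equations for odd ½-superderivations of degree 0 on the Kantor
double of the Virasoro-like algebra, after the even coefficients `a` are shown to be constant.
If `a ∈ ℂ` and `b : ℤ² \ {0} → ℂ` satisfy, for all nonzero `m, n` with `m+n ≠ 0`,
`2·det(n;m)·b(m+n) = a + det(n;m)·b(n)` and `2·a = det(n;m)·b(m) − det(n;m)·b(n)`,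
then `a = 0` and `b ≡ 0`. -/
theorem stmt5 (a : ℂ) (b : ℤ × ℤ → ℂ)
    (h1 : ∀ m n : ℤ × ℤ, m ≠ 0 → n ≠ 0 → m + n ≠ 0 →
      2 * ((n.1 * m.2 - n.2 * m.1 : ℤ) : ℂ) * b (m + n) =
        a + ((n.1 * m.2 - n.2 * m.1 : ℤ) : ℂ) * b n)
    (h2 : ∀ m n : ℤ × ℤ, m ≠ 0 → n ≠ 0 → m + n ≠ 0 →
      2 * a = ((n.1 * m.2 - n.2 * m.1 : ℤ) : ℂ) * b m - ((n.1 * m.2 - n.2 * m.1 : ℤ) : ℂ) * b n) :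
    a = 0 ∧ ∀ m : ℤ × ℤ, m ≠ 0 → b m = 0 := by
  have ha : a = 0 := by
    have := h1 (1, 0) (1, 0) (by simp) (by simp) (by simp)
    simpa using this.symm
  refine ⟨ha, ?_⟩
  rintro ⟨x, y⟩ hn
  subst ha
  have hd : 0 < x * x + y * y := by
    by_contra hc
    apply hn
    have hx : x = 0 := by nlinarith [mul_self_nonneg x, mul_self_nonneg y]
    have hy : y = 0 := by nlinarith [mul_self_nonneg x, mul_self_nonneg y]
    simp [hx, hy]
  have key : ∀ u v : ℤ, x * v - y * u = x * x + y * y → ((u, v) : ℤ × ℤ) ≠ 0 := by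
    intro u v h h0
    simp only [Prod.mk_eq_zero] at h0
    rw [h0.1, h0.2] at h
    simp at h
    omega
  have e1 := h1 (-y, x) (x, y) (key _ _ (by ring)) hn (key (-y + x) (x + y) (by ring))
  have e2 := h2 (-y + x, x + y) (x, y) (key _ _ (by ring)) hn
    (key (-y + x + x) (x + y + y) (by ring))
  have hD : ((x * x + y * y : ℤ) : ℂ) ≠ 0 := by exact_mod_cast hd.ne'
  have d1 : x * x - y * -y = x * x + y * y := by ring
  have d2 : x * (x + y) - y * (-y + x) = x * x + y * y := by ring
  simp only [Prod.mk_add_mk, d1] at e1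
  simp only [d2] at e2
  apply (mul_eq_zero.mp _).resolve_left hD
  linear_combination e1 + 2 * e2
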